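/- Let φ ∈ C*(𝕋) with φ̂(1) ≠ 0 and f ∈ C*(𝕋^q). Then for all integers n, N ≥ 1, ‖f − 𝔾_N(φ, σ_n(f))‖ ≤ c(φ) { E_{n/2}(q; f) + n^{q/2} E_N(1; φ) ‖f‖ }, where c(φ) is a constant depending only on q, h, and φ. -/

import Mathlib

open MeasureTheory Real

noncomputable section

instance fact_two_pi_pos : Fact (0 < 2 * π) := ⟨by positivity⟩

/-- The `q`-dimensional torus `ℝ^q/(2πℤ)^q`, with the max metric. -/
abbrev Torus (q : ℕ) := Fin q → AddCircle (2 * π)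

/-- The exponential `x ↦ exp(i k·x)` on the torus. -/
def eK {q : ℕ} (k : Fin q → ℤ) : C(Torus q, ℂ) :=
  ⟨fun x => ∏ j, fourier (k j) (x j),
    continuous_finset_prod _ fun j _ => (map_continuous (fourier (k j))).comp (continuous_apply j)⟩

/-- The Euclidean norm `|k|₂` of a multi-integer. -/
def l2 {q : ℕ} (k : Fin q → ℤ) : ℝ := Real.sqrt (∑ j, ((k j : ℝ)) ^ 2)

/-- The space `H_n^q` of trigonometric polynomials of spherical degree `< n`. -/
def trigSpan (q : ℕ) (n : ℝ) : Submodule ℂ C(Torus q, ℂ) :=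
  Submodule.span ℂ {T | ∃ k : Fin q → ℤ, l2 k < n ∧ T = eK k}

/-- The degree of approximation `E_n(q; f)` in the supremum norm. -/
def degApprox (q : ℕ) (n : ℝ) (f : C(Torus q, ℂ)) : ℝ :=
  ⨅ T : ↥(trigSpan q n), ‖f - (T : C(Torus q, ℂ))‖

/-- The multivariate Fourier coefficient `f̂(k)`. -/
def mFourierCoeff {q : ℕ} (f : C(Torus q, ℂ)) (k : Fin q → ℤ) : ℂ :=
  (1 / ((2 * π : ℝ) : ℂ) ^ q) * ∫ x : Torus q, f x * (starRingEnd ℂ) (eK k x)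

/-- The box of frequencies used to write `Φ_N` and `σ_N` as finite sums. -/
def box (q : ℕ) (N : ℝ) : Finset (Fin q → ℤ) :=
  Finset.Icc (fun _ => -⌈N⌉) (fun _ => ⌈N⌉)

/-- The fixed smooth cutoff function `h`. -/
structure SmoothCutoff (h : ℝ → ℝ) : Prop where
  smooth : ContDiff ℝ (⊤ : ℕ∞) h
  even : ∀ t, h (-t) = h t
  nonneg : ∀ t, 0 ≤ h t
  le_one : ∀ t, h t ≤ 1
  eq_one : ∀ t, |t| ≤ 1 / 2 → h t = 1
  eq_zero : ∀ t, 1 ≤ |t| → h t = 0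

/-- The localized kernel `Φ_N(x) = Σ_k h(|k|₂/N) exp(i k·x)`. -/
def Phi (q : ℕ) (h : ℝ → ℝ) (N : ℝ) : C(Torus q, ℂ) :=
  ∑ k ∈ box q N, ((h (l2 k / N) : ℝ) : ℂ) • eK k

/-- The operator `σ_N(f)(x) = Σ_k h(|k|₂/N) f̂(k) exp(i k·x)`. -/
def sigmaOp (q : ℕ) (h : ℝ → ℝ) (N : ℝ) (f : C(Torus q, ℂ)) : C(Torus q, ℂ) :=
  ∑ k ∈ box q N, (((h (l2 k / N) : ℝ) : ℂ) * mFourierCoeff f k) • eK k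

/-- Minimal separation `η(C)` of the points of `C = {x_1, …, x_M}`. -/
def minSep {q M : ℕ} (x : Fin M → Torus q) : ℝ :=
  sInf {d | ∃ i j, x i ≠ x j ∧ d = dist (x i) (x j)}

/-- `x ↦ k·x` on the torus. -/
def dotk {q : ℕ} (k : Fin q → ℤ) : C(Torus q, AddCircle (2 * π)) :=
  ⟨fun x => ∑ j, k j • x j,
    continuous_finset_sum _ fun j _ => (continuous_zsmul (k j)).comp (continuous_apply j)⟩

/-- `x ↦ φ(k·x − t)`, a single neuron. -/
def transK {q : ℕ} (φ : C(AddCircle (2 * π), ℂ)) (k : Fin q → ℤ) (t : ℝ) : C(Torus q, ℂ) :=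
  φ.comp ⟨fun x => dotk k x - (t : AddCircle (2 * π)), (dotk k).continuous.sub continuous_const⟩

/-- The network `𝔾_Nt(φ, T)` associated with the trigonometric polynomial
`T = Σ_{k ∈ K} c k exp(i k ⬝ ·)`. -/
def Gop {q : ℕ} (φ : C(AddCircle (2 * π), ℂ)) (Nt : ℕ) (K : Finset (Fin q → ℤ))
    (c : (Fin q → ℤ) → ℂ) : C(Torus q, ℂ) :=
  (1 / (((2 * Nt + 1 : ℕ) : ℂ) * fourierCoeff (⇑φ) 1)) •
    ∑ j ∈ Finset.range (2 * Nt + 1),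
      Complex.exp (2 * (π : ℂ) * Complex.I * (j : ℂ) / ((2 * Nt + 1 : ℕ) : ℂ)) •
        ∑ k ∈ K, c k • transK φ k (2 * π * (j : ℝ) / ((2 * Nt + 1 : ℕ) : ℝ))

/-- The network `𝔾_Nt(φ, Φ_N)`. -/
def GPhiOp (q : ℕ) (h : ℝ → ℝ) (φ : C(AddCircle (2 * π), ℂ)) (Nt : ℕ) (N : ℝ) :
    C(Torus q, ℂ) :=
  Gop φ Nt (box q N) fun k => ((h (l2 k / N) : ℝ) : ℂ)

/-- The network `𝔾_Nt(φ, σ_n(f))`. -/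
def GsigmaOp (q : ℕ) (h : ℝ → ℝ) (φ : C(AddCircle (2 * π), ℂ)) (Nt : ℕ) (n : ℝ)
    (f : C(Torus q, ℂ)) : C(Torus q, ℂ) :=
  Gop φ Nt (box q n) fun k => ((h (l2 k / n) : ℝ) : ℂ) * mFourierCoeff f k

/-- Univariate trigonometric polynomials of degree `< n`. -/
def trigSpan1 (n : ℝ) : Submodule ℂ C(AddCircle (2 * π), ℂ) :=
  Submodule.span ℂ {T | ∃ k : ℤ, |(k : ℝ)| < n ∧ T = fourier k}

/-- The univariate degree of approximation `E_n(1; φ)`. -/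
def degApprox1 (n : ℝ) (φ : C(AddCircle (2 * π), ℂ)) : ℝ :=
  ⨅ T : ↥(trigSpan1 n), ‖φ - (T : C(AddCircle (2 * π), ℂ))‖

/-- Univariate trigonometric polynomials of degree `≤ m`. -/
def trigSpanLe1 (m : ℝ) : Submodule ℂ C(AddCircle (2 * π), ℂ) :=
  Submodule.span ℂ {T | ∃ k : ℤ, |(k : ℝ)| ≤ m ∧ T = fourier k}

/-- The degree of approximation by univariate trigonometric polynomials of degree `≤ m`. -/
def degApproxLe1 (m : ℝ) (φ : C(AddCircle (2 * π), ℂ)) : ℝ :=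
  ⨅ T : ↥(trigSpanLe1 m), ‖φ - (T : C(AddCircle (2 * π), ℂ))‖

/-- Projection of `ℝ^q` onto the torus. -/
def projT {q : ℕ} (x : Fin q → ℝ) : Torus q := fun j => (x j : AddCircle (2 * π))

/-- The `2π`-periodic lift to `ℝ^q` of a function on the torus. -/
def liftT {q : ℕ} (f : C(Torus q, ℂ)) : (Fin q → ℝ) → ℂ := fun x => f (projT x)

/-- `f ∈ W*(𝕋^q)`: `f` is continuously differentiable. -/
def MemW {q : ℕ} (f : C(Torus q, ℂ)) : Prop := ContDiff ℝ 1 (liftT f)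

/-- The `W*` seminorm `Σ_j ‖D_j f‖`. -/
def Wnorm {q : ℕ} (f : C(Torus q, ℂ)) : ℝ :=
  ∑ j, ⨆ x : Fin q → ℝ, ‖fderiv ℝ (liftT f) x (Pi.single j 1)‖

/-- Degree of approximation of a (not necessarily continuous) periodic function on `ℝ^q`. -/
def degApprox' (q : ℕ) (n : ℝ) (g : (Fin q → ℝ) → ℂ) : ℝ :=
  ⨅ T : ↥(trigSpan q n), ⨆ x : Fin q → ℝ, ‖g x - (T : C(Torus q, ℂ)) (projT x)‖

/-- Degree of approximation of a (not necessarily continuous) `2π`-periodic function on `ℝ`. -/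
def degApprox1' (n : ℝ) (g : ℝ → ℂ) : ℝ :=
  ⨅ T : ↥(trigSpan1 n), ⨆ t : ℝ, ‖g t - (T : C(AddCircle (2 * π), ℂ)) (t : AddCircle (2 * π))‖

/-- The regularization functional `R_N(T)`. -/
def regFunc {q M : ℕ} (N : ℝ) (x : Fin M → Torus q) (y : Fin M → ℂ) (T : C(Torus q, ℂ)) : ℝ :=
  (⨆ j, ‖y j - T (x j)‖) + (1 / N) * Wnorm T

/-- Translate of a function on the torus. -/
def translateC {q : ℕ} (g : C(Torus q, ℂ)) (z : Torus q) : C(Torus q, ℂ) :=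
  g.comp ⟨fun w => w - z, continuous_id.sub continuous_const⟩

/-- The interpolant `T^#_N(D) = σ_N(f) + Σ_j a_j Φ_N(· − x_j)`. -/
def interpolant {q M : ℕ} (h : ℝ → ℝ) (N : ℝ) (f : C(Torus q, ℂ)) (x : Fin M → Torus q)
    (a : Fin M → ℂ) : C(Torus q, ℂ) :=
  sigmaOp q h N f + ∑ j, a j • translateC (Phi q h N) (x j)

end

section UnivariateNeuron

theorem fourier_one_dotk {q : ℕ} (k : Fin q → ℤ) (x : Torus q) :
    fourier 1 (dotk k x) = eK k x := by
  simp only [eK, dotk, ContinuousMap.coe_mk, fourier_apply, one_zsmul]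
  induction (Finset.univ : Finset (Fin q)) using Finset.induction_on with
  | empty => simp
  | insert a s ha ih =>
    rw [Finset.sum_insert ha, Finset.prod_insert ha, AddCircle.toCircle_add, Circle.coe_mul, ih]

theorem norm_eK_apply {q : ℕ} (k : Fin q → ℤ) (x : Torus q) : ‖eK k x‖ = 1 := by
  rw [← fourier_one_dotk, fourier_apply, Circle.norm_coe]

theorem fourierCoeff_fourier_one (k : ℤ) :
    fourierCoeff (⇑(fourier k : C(AddCircle (2 * π), ℂ))) 1 = if k = 1 then 1 else 0 := by
  have key := orthonormal_iff_ite.mp (orthonormal_fourier (T := 2 * π)) 1 k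
  rw [fourierLp, fourierLp, ContinuousMap.inner_toLp] at key
  rw [fourierCoeff, show (if k = 1 then (1 : ℂ) else 0) = if 1 = k then 1 else 0 by
    simp only [eq_comm], ← key]
  refine integral_congr_ae (.of_forall fun x => ?_)
  simp only [fourier_neg, smul_eq_mul]
  ring

theorem norm_fourierCoeff_le (f : C(AddCircle (2 * π), ℂ)) (k : ℤ) :
    ‖fourierCoeff (⇑f) k‖ ≤ ‖f‖ := by
  refine (norm_integral_le_of_norm_le_const (C := ‖f‖) (.of_forall fun x => ?_)).trans ?_
  · rw [norm_smul, fourier_apply, Circle.norm_coe, one_mul]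
    exact f.norm_coe_le_norm x
  · simp

/-- Summing a nontrivial power of a root of unity over a full period gives zero. -/
theorem sum_exp_eq_zero {M : ℕ} {l : ℤ} (hM : 0 < M) (hl : ¬ (M : ℤ) ∣ l) :
    ∑ j ∈ Finset.range M, Complex.exp (2 * (π : ℂ) * Complex.I * (l : ℂ) / M) ^ j = 0 := by
  have hM' : (M : ℂ) ≠ 0 := by exact_mod_cast hM.ne'
  have hne : Complex.exp (2 * (π : ℂ) * Complex.I * (l : ℂ) / M) ≠ 1 := by
    rw [Ne, Complex.exp_eq_one_iff]
    rintro ⟨m, hm⟩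
    apply hl
    refine ⟨m, ?_⟩
    have h2 := Complex.two_pi_I_ne_zero
    have : (2 * (π : ℂ) * Complex.I) * (l : ℂ) = (2 * (π : ℂ) * Complex.I) * (M * m) := by
      field_simp at hm
      linear_combination (2 * (π : ℂ) * Complex.I) * hm
    exact_mod_cast mul_left_cancel₀ h2 this
  rw [geom_sum_eq hne, ← Complex.exp_nat_mul, mul_div_cancel₀ _ hM',
    show 2 * (π : ℂ) * Complex.I * (l : ℂ) = l * (2 * π * Complex.I) by ring,
    Complex.exp_int_mul_two_pi_mul_I, sub_self, zero_div]

/-- The quadrature average `(1/(2N+1)) Σ_j exp(2πij/(2N+1)) φ(u − 2πj/(2N+1))`. -/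
noncomputable def neuronAverage (N : ℕ) (φ : C(AddCircle (2 * π), ℂ)) (u : AddCircle (2 * π)) : ℂ :=
  (1 / ((2 * N + 1 : ℕ) : ℂ)) * ∑ j ∈ Finset.range (2 * N + 1),
    Complex.exp (2 * (π : ℂ) * Complex.I * (j : ℂ) / ((2 * N + 1 : ℕ) : ℂ)) *
      φ (u - ((2 * π * (j : ℝ) / ((2 * N + 1 : ℕ) : ℝ) : ℝ) : AddCircle (2 * π)))

theorem norm_neuronAverage_le (N : ℕ) (φ : C(AddCircle (2 * π), ℂ)) (u : AddCircle (2 * π)) :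
    ‖neuronAverage N φ u‖ ≤ ‖φ‖ := by
  have hM : (0 : ℝ) < ((2 * N + 1 : ℕ) : ℝ) := by positivity
  rw [neuronAverage, norm_mul, norm_div, norm_one, Complex.norm_natCast, one_div,
    inv_mul_le_iff₀ hM]
  refine (norm_sum_le_of_le (n := fun _ => ‖φ‖) _ fun j _ => ?_).trans (by simp)
  rw [norm_mul, show 2 * (π : ℂ) * Complex.I * (j : ℂ) / ((2 * N + 1 : ℕ) : ℂ) =
    ((2 * π * j / ((2 * N + 1 : ℕ) : ℝ) : ℝ) : ℂ) * Complex.I by push_cast; ring,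
    Complex.norm_exp_ofReal_mul_I, one_mul]
  exact φ.norm_coe_le_norm _

theorem neuronAverage_fourier {N : ℕ} {k : ℤ} (hk : |(k : ℝ)| < N) (u : AddCircle (2 * π)) :
    neuronAverage N (fourier k) u = (if k = 1 then 1 else 0) * fourier 1 u := by
  have hM : ((2 * N + 1 : ℕ) : ℂ) ≠ 0 := by exact_mod_cast Nat.succ_ne_zero (2 * N)
  have hterm : ∀ j : ℕ, Complex.exp (2 * (π : ℂ) * Complex.I * (j : ℂ) / ((2 * N + 1 : ℕ) : ℂ)) *
      fourier k (u - ((2 * π * (j : ℝ) / ((2 * N + 1 : ℕ) : ℝ) : ℝ) : AddCircle (2 * π))) =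
      fourier k u * Complex.exp (2 * (π : ℂ) * Complex.I * ((1 - k : ℤ) : ℂ) /
        ((2 * N + 1 : ℕ) : ℂ)) ^ j := by
    intro j
    rw [sub_eq_add_neg, fourier_apply, smul_add, AddCircle.toCircle_add, Circle.coe_mul,
      ← fourier_apply, ← AddCircle.coe_neg, ← fourier_apply, fourier_coe_apply,
      mul_left_comm, ← Complex.exp_add, ← Complex.exp_nat_mul]
    congr 2
    have : (π : ℂ) ≠ 0 := by exact_mod_cast pi_ne_zero
    push_cast at hM ⊢
    field_simp
    ring
  rw [neuronAverage, Finset.sum_congr rfl fun j _ => hterm j, ← Finset.mul_sum]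
  split_ifs with h
  · subst h
    simp only [sub_self, Int.cast_zero, mul_zero, zero_div, Complex.exp_zero, one_pow,
      Finset.sum_const, Finset.card_range, nsmul_eq_mul, mul_one, one_mul]
    field_simp
  · rw [sum_exp_eq_zero (Nat.succ_pos _), mul_zero, mul_zero, zero_mul]
    intro hd
    have hkN : |k| < N := by exact_mod_cast hk
    rw [abs_lt] at hkN
    obtain h1 := Int.eq_zero_of_abs_lt_dvd hd (by rw [abs_lt]; push_cast; constructor <;> omega)
    omega

theorem neuronAverage_trigSpan1 {N : ℕ} {P : C(AddCircle (2 * π), ℂ)} (hP : P ∈ trigSpan1 N)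
    (u : AddCircle (2 * π)) :
    neuronAverage N P u = fourierCoeff (⇑P) 1 * fourier 1 u := by
  induction hP using Submodule.span_induction with
  | mem P hP =>
    obtain ⟨k, hk, rfl⟩ := hP
    rw [neuronAverage_fourier hk, fourierCoeff_fourier_one]
  | zero => simp [neuronAverage, fourierCoeff]
  | add P Q _ _ hP hQ =>
    rw [ContinuousMap.coe_add, fourierCoeff.add (P.continuous.integrable_of_hasCompactSupport
      (.of_compactSpace _)) (Q.continuous.integrable_of_hasCompactSupport (.of_compactSpace _)),
      Pi.add_apply, add_mul, ← hP, ← hQ]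
    simp only [neuronAverage, ContinuousMap.add_apply, mul_add, Finset.sum_add_distrib]
  | smul a P _ hP =>
    rw [ContinuousMap.coe_smul, fourierCoeff.const_smul, smul_eq_mul, mul_assoc, ← hP]
    simp only [neuronAverage, ContinuousMap.smul_apply, smul_eq_mul, Finset.mul_sum]
    exact Finset.sum_congr rfl fun j _ => by ring

theorem norm_sub_neuronAverage_le (N : ℕ) (φ : C(AddCircle (2 * π), ℂ)) (u : AddCircle (2 * π)) :
    ‖fourierCoeff (⇑φ) 1 * fourier 1 u - neuronAverage N φ u‖ ≤ 2 * degApprox1 N φ := by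
  rw [← div_le_iff₀' two_pos]
  refine le_ciInf fun P => ?_
  rw [div_le_iff₀' two_pos]
  have hint (f : C(AddCircle (2 * π), ℂ)) : Integrable f AddCircle.haarAddCircle :=
    f.continuous.integrable_of_hasCompactSupport (.of_compactSpace _)
  set R : C(AddCircle (2 * π), ℂ) := φ - P with hR
  have hφ : φ = P + R := by rw [hR]; abel
  have hcoeff : fourierCoeff (⇑φ) 1 = fourierCoeff (⇑(P : C(AddCircle (2 * π), ℂ))) 1 +
      fourierCoeff (⇑R) 1 := by
    conv_lhs => rw [hφ, ContinuousMap.coe_add, fourierCoeff.add (hint _) (hint _)]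
    rfl
  have havg : neuronAverage N φ u = neuronAverage N P u + neuronAverage N R u := by
    conv_lhs => rw [hφ]
    simp only [neuronAverage, ContinuousMap.add_apply, mul_add, Finset.sum_add_distrib]
  rw [hcoeff, havg, neuronAverage_trigSpan1 P.2, add_mul, add_sub_add_left_eq_sub, two_mul ‖R‖]
  refine (norm_sub_le _ _).trans (add_le_add ?_ (norm_neuronAverage_le _ _ _))
  rw [norm_mul, fourier_apply, Circle.norm_coe, mul_one]
  exact norm_fourierCoeff_le _ _

end UnivariateNeuron

section TorusFourier

variable {q : ℕ}

theorem integral_eK_mul_conj_eK (m k : Fin q → ℤ) :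
    ∫ x : Torus q, eK m x * (starRingEnd ℂ) (eK k x) =
      if m = k then ((2 * π : ℝ) : ℂ) ^ q else 0 := by
  have hint : ∀ x : Torus q, eK m x * (starRingEnd ℂ) (eK k x) =
      ∏ j, (fourier (m j) (x j) * (starRingEnd ℂ) (fourier (k j) (x j)) : ℂ) := fun x => by
    simp only [eK, ContinuousMap.coe_mk, map_prod, Finset.prod_mul_distrib]
  have hone : ∀ a b : ℤ, ∫ t : AddCircle (2 * π),
      (fourier a t * (starRingEnd ℂ) (fourier b t) : ℂ) =
        if a = b then ((2 * π : ℝ) : ℂ) else 0 := fun a b => by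
    have key := orthonormal_iff_ite.mp (orthonormal_fourier (T := 2 * π)) b a
    rw [fourierLp, fourierLp, ContinuousMap.inner_toLp] at key
    rw [AddCircle.volume_eq_smul_haarAddCircle, integral_smul_measure, key,
      ENNReal.toReal_ofReal two_pi_pos.le]
    simp only [eq_comm (a := b), smul_ite, smul_zero, Complex.real_smul, mul_one]
  simp_rw [hint]
  rw [integral_fintype_prod_volume_eq_prod
    (f := fun j t => (fourier (m j) t * (starRingEnd ℂ) (fourier (k j) t) : ℂ))]
  simp_rw [hone]
  split_ifs with h
  · simp [h]
  · obtain ⟨i, hi⟩ := Function.ne_iff.mp h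
    exact Finset.prod_eq_zero (Finset.mem_univ i) (if_neg hi)

theorem mFourierCoeff_eK (m k : Fin q → ℤ) :
    mFourierCoeff (eK m) k = if m = k then 1 else 0 := by
  have : ((2 * π : ℝ) : ℂ) ^ q ≠ 0 := pow_ne_zero _ (by exact_mod_cast two_pi_pos.ne')
  rw [mFourierCoeff, integral_eK_mul_conj_eK, mul_ite, mul_zero, one_div, inv_mul_cancel₀ this]

theorem integrable_mul_conj_eK (f : C(Torus q, ℂ)) (k : Fin q → ℤ) :
    Integrable fun x : Torus q => f x * (starRingEnd ℂ) (eK k x) :=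
  Continuous.integrable_of_hasCompactSupport
    (f.continuous.mul (Complex.continuous_conj.comp (eK k).continuous)) (.of_compactSpace _)

/-- The Fourier coefficient as a linear functional. -/
noncomputable def mFourierCoeffLinear (k : Fin q → ℤ) : C(Torus q, ℂ) →ₗ[ℂ] ℂ where
  toFun f := mFourierCoeff f k
  map_add' f g := by
    simp only [mFourierCoeff, ContinuousMap.add_apply, add_mul]
    rw [integral_add (integrable_mul_conj_eK f k) (integrable_mul_conj_eK g k), mul_add]
  map_smul' a f := by
    simp only [mFourierCoeff, ContinuousMap.smul_apply, smul_eq_mul, mul_assoc, RingHom.id_apply]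
    rw [integral_const_mul, mul_left_comm]

/-- Bessel's inequality on the torus. -/
theorem sum_norm_sq_mFourierCoeff_le (f : C(Torus q, ℂ)) (K : Finset (Fin q → ℤ)) :
    ∑ k ∈ K, ‖mFourierCoeff f k‖ ^ 2 ≤ ‖f‖ ^ 2 := by
  have hA : (0 : ℝ) < (2 * π) ^ q := by positivity
  let μ : Measure (Torus q) := (ENNReal.ofReal ((2 * π) ^ q))⁻¹ • volume
  have huniv : (volume : Measure (Torus q)) Set.univ = ENNReal.ofReal ((2 * π) ^ q) := by
    rw [← Set.pi_univ Set.univ, volume_pi_pi]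
    simp only [AddCircle.measure_univ, Finset.prod_const, Finset.card_univ, Fintype.card_fin]
    rw [ENNReal.ofReal_pow two_pi_pos.le]
  have : IsProbabilityMeasure μ := ⟨by
    rw [Measure.smul_apply, huniv, smul_eq_mul]
    exact ENNReal.inv_mul_cancel (by simpa using hA) ENNReal.ofReal_ne_top⟩
  have hinner (g : C(Torus q, ℂ)) (k : Fin q → ℤ) : inner ℂ (ContinuousMap.toLp 2 μ ℂ (eK k))
      (ContinuousMap.toLp 2 μ ℂ g) = mFourierCoeff g k := by
    rw [ContinuousMap.inner_toLp, integral_smul_measure, mFourierCoeff, ENNReal.toReal_inv,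
      ENNReal.toReal_ofReal hA.le, Complex.real_smul]
    push_cast
    rw [one_div]
  have horth : Orthonormal ℂ fun k : Fin q → ℤ => ContinuousMap.toLp 2 μ ℂ (eK k) := by
    rw [orthonormal_iff_ite]
    intro i j
    rw [hinner, mFourierCoeff_eK]
    simp only [eq_comm]
  have hb := horth.sum_inner_products_le (ContinuousMap.toLp 2 μ ℂ f) (s := K)
  simp only [hinner] at hb
  refine hb.trans (pow_le_pow_left₀ (norm_nonneg _) ?_ 2)
  refine ((ContinuousMap.toLp 2 μ ℂ).le_opNorm f).trans ?_
  refine mul_le_of_le_one_left (norm_nonneg _) ((ContinuousMap.toLp_norm_le μ).trans ?_)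
  simp [measureUnivNNReal]

theorem norm_mFourierCoeff_le (f : C(Torus q, ℂ)) (k : Fin q → ℤ) : ‖mFourierCoeff f k‖ ≤ ‖f‖ := by
  have := sum_norm_sq_mFourierCoeff_le f {k}
  rw [Finset.sum_singleton] at this
  exact (sq_le_sq₀ (norm_nonneg _) (norm_nonneg _)).mp this

theorem sum_norm_mFourierCoeff_le (f : C(Torus q, ℂ)) (K : Finset (Fin q → ℤ)) :
    ∑ k ∈ K, ‖mFourierCoeff f k‖ ≤ √K.card * ‖f‖ := by
  refine abs_le_of_sq_le_sq' ?_ (by positivity) |>.2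
  rw [mul_pow, Real.sq_sqrt (by positivity)]
  exact sq_sum_le_card_mul_sum_sq.trans
    (mul_le_mul_of_nonneg_left (sum_norm_sq_mFourierCoeff_le f K) (by positivity))

/-- Trigonometric polynomials are dense in the continuous functions on the torus. -/
theorem span_eK_closure_eq_top :
    (Submodule.span ℂ (Set.range (eK (q := q)))).topologicalClosure = ⊤ := by
  let A : StarSubalgebra ℂ C(Torus q, ℂ) :=
    { toSubalgebra := Algebra.adjoin ℂ (Set.range eK)
      star_mem' := by
        change Algebra.adjoin ℂ (Set.range eK) ≤ star (Algebra.adjoin ℂ (Set.range eK))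
        refine Algebra.adjoin_le ?_
        rintro _ ⟨n, rfl⟩
        refine Algebra.subset_adjoin ⟨-n, ?_⟩
        ext1 x
        simp only [eK, ContinuousMap.coe_mk, Pi.neg_apply, fourier_neg, ContinuousMap.star_apply,
          RCLike.star_def, map_prod] }
  have hspan : A.toSubalgebra.toSubmodule = Submodule.span ℂ (Set.range eK) := by
    apply Algebra.adjoin_eq_span_of_subset
    refine .trans (fun x ↦ Submonoid.closure_induction (fun _ ↦ id) ⟨0, ?_⟩ ?_)
      Submodule.subset_span
    · ext z
      simp [eK]
    · rintro _ _ _ _ ⟨m, rfl⟩ ⟨n, rfl⟩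
      refine ⟨m + n, ?_⟩
      ext z
      simp only [eK, Pi.add_apply, fourier_add, Finset.prod_mul_distrib,
        ContinuousMap.coe_mk, ContinuousMap.mul_apply]
  have hsep : A.SeparatesPoints := by
    intro x y hxy
    obtain ⟨i, hi⟩ := Function.ne_iff.mp hxy
    have hsingle (z : Torus q) : eK (Pi.single i 1) z = AddCircle.toCircle (z i) := by
      rw [← fourier_one_dotk, ← fourier_one]
      simp [dotk, Pi.single_apply, ite_smul]
    refine ⟨_, ⟨eK (Pi.single i 1), Algebra.subset_adjoin ⟨Pi.single i 1, rfl⟩, rfl⟩, ?_⟩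
    change eK (Pi.single i 1) x ≠ eK (Pi.single i 1) y
    rw [hsingle, hsingle, Ne, Circle.coe_inj]
    contrapose hi
    exact AddCircle.injective_toCircle two_pi_pos.ne' hi
  rw [← hspan]
  exact congr_arg (Subalgebra.toSubmodule <| StarSubalgebra.toSubalgebra ·)
    (ContinuousMap.starSubalgebra_topologicalClosure_eq_top_of_separatesPoints A hsep)

end TorusFourier

section SigmaBound

open scoped FourierTransform SchwartzMap

variable {q : ℕ} {h : ℝ → ℝ}

theorem SmoothCutoff.contDiff_norm (hh : SmoothCutoff h) :
    ContDiff ℝ (⊤ : ℕ∞) fun x : EuclideanSpace ℝ (Fin q) => ((h ‖x‖ : ℝ) : ℂ) := by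
  refine Complex.ofRealCLM.contDiff.comp (contDiff_iff_contDiffAt.mpr fun x => ?_)
  rcases eq_or_ne x 0 with rfl | hx
  · refine (contDiffAt_const (c := (1 : ℝ))).congr_of_eventuallyEq ?_
    filter_upwards [Metric.ball_mem_nhds (0 : EuclideanSpace ℝ (Fin q)) (half_pos one_pos)]
      with y hy
    rw [mem_ball_zero_iff] at hy
    exact hh.eq_one _ (by rw [abs_norm]; exact hy.le)
  · exact hh.smooth.contDiffAt.comp x (contDiffAt_norm ℝ hx)

theorem SmoothCutoff.hasCompactSupport_norm (hh : SmoothCutoff h) :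
    HasCompactSupport fun x : EuclideanSpace ℝ (Fin q) => ((h ‖x‖ : ℝ) : ℂ) := by
  refine HasCompactSupport.intro (isCompact_closedBall 0 1) fun x hx => ?_
  rw [mem_closedBall_zero_iff, not_le] at hx
  rw [hh.eq_zero _ (by rw [abs_norm]; exact hx.le), Complex.ofReal_zero]

/-- A radial smooth cutoff is the inverse Fourier transform of an integrable function. -/
theorem SmoothCutoff.exists_integrable_fourierInv (hh : SmoothCutoff h) :
    ∃ G : EuclideanSpace ℝ (Fin q) → ℂ, Integrable G ∧ ∀ v : EuclideanSpace ℝ (Fin q),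
      ((h ‖v‖ : ℝ) : ℂ) =
        ∫ w, G w * Complex.exp (((2 * π * inner ℝ w v : ℝ) : ℂ) * Complex.I) := by
  let g : 𝓢(EuclideanSpace ℝ (Fin q), ℂ) :=
    (hh.hasCompactSupport_norm (q := q)).toSchwartzMap hh.contDiff_norm
  refine ⟨⇑(𝓕 g : 𝓢(EuclideanSpace ℝ (Fin q), ℂ)), SchwartzMap.integrable _, fun v => ?_⟩
  have hg : 𝓕⁻ (𝓕 g) = g := FourierTransform.fourierInv_fourier_eq g
  calc ((h ‖v‖ : ℝ) : ℂ) = g v := rfl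
    _ = 𝓕⁻ (⇑(𝓕 g : 𝓢(EuclideanSpace ℝ (Fin q), ℂ))) v := by
      conv_lhs => rw [← hg, SchwartzMap.fourierInv_coe]
    _ = _ := by
      rw [Real.fourierInv_eq']
      exact integral_congr_ae (.of_forall fun w => by simp only [smul_eq_mul]; ring)

theorem abs_le_l2 (k : Fin q → ℤ) (j : Fin q) : |(k j : ℝ)| ≤ l2 k :=
  Real.abs_le_sqrt (Finset.single_le_sum (f := fun j => (k j : ℝ) ^ 2)
    (fun _ _ => sq_nonneg _) (Finset.mem_univ j))

theorem mem_box_of_l2_le {k : Fin q → ℤ} {N : ℝ} (hk : l2 k ≤ N) : k ∈ box q N := by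
  have (j : Fin q) : |k j| ≤ ⌈N⌉ := by
    have := ((abs_le_l2 k j).trans hk).trans (Int.le_ceil N)
    exact_mod_cast this
  exact Finset.mem_Icc.mpr ⟨fun j => (abs_le.mp (this j)).1, fun j => (abs_le.mp (this j)).2⟩

theorem sigmaOp_eK (hh : SmoothCutoff h) {n : ℝ} (hn : 0 < n) (m : Fin q → ℤ) :
    sigmaOp q h n (eK m) = ((h (l2 m / n) : ℝ) : ℂ) • eK m := by
  rw [sigmaOp, Finset.sum_eq_single m]
  · rw [mFourierCoeff_eK, if_pos rfl, mul_one]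
  · intro k _ hk
    rw [mFourierCoeff_eK, if_neg hk.symm, mul_zero, zero_smul]
  · intro hm
    have h1 : 1 ≤ l2 m / n := by
      rw [one_le_div hn]
      exact (not_le.mp fun hle => hm (mem_box_of_l2_le hle)).le
    rw [hh.eq_zero _ (h1.trans (le_abs_self _)), Complex.ofReal_zero, zero_mul, zero_smul]

theorem sigmaOp_add (n : ℝ) (f g : C(Torus q, ℂ)) :
    sigmaOp q h n (f + g) = sigmaOp q h n f + sigmaOp q h n g := by
  rw [sigmaOp, sigmaOp, sigmaOp, ← Finset.sum_add_distrib]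
  refine Finset.sum_congr rfl fun k _ => ?_
  rw [← add_smul, ← mul_add]
  exact congrArg (fun z => (_ * z) • _) ((mFourierCoeffLinear k).map_add f g)

theorem sigmaOp_smul (n : ℝ) (a : ℂ) (f : C(Torus q, ℂ)) :
    sigmaOp q h n (a • f) = a • sigmaOp q h n f := by
  rw [sigmaOp, sigmaOp, Finset.smul_sum]
  refine Finset.sum_congr rfl fun k _ => ?_
  rw [smul_smul, mul_left_comm]
  exact congrArg (fun z => (_ * z) • _) ((mFourierCoeffLinear k).map_smul a f)

theorem continuous_sigmaOp (n : ℝ) : Continuous (sigmaOp q h n) := by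
  have hcoeff (k : Fin q → ℤ) : Continuous fun f : C(Torus q, ℂ) => mFourierCoeff f k :=
    ((mFourierCoeffLinear k).mkContinuous 1 fun f => by
      rw [one_mul]; exact norm_mFourierCoeff_le f k).continuous
  exact continuous_finsetSum _ fun k _ =>
    (continuous_const.mul (hcoeff k)).smul (continuous_const (y := eK k))

theorem eK_add_projT (m : Fin q → ℤ) (x : Torus q) (v : Fin q → ℝ) :
    eK m (x + projT v) =
      eK m x * Complex.exp (((∑ j, (m j : ℝ) * v j : ℝ) : ℂ) * Complex.I) := by
  simp only [eK, projT, ContinuousMap.coe_mk, Pi.add_apply]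
  rw [Complex.ofReal_sum, Finset.sum_mul, Complex.exp_sum, ← Finset.prod_mul_distrib]
  refine Finset.prod_congr rfl fun j _ => ?_
  rw [fourier_apply, smul_add, AddCircle.toCircle_add, Circle.coe_mul, ← fourier_apply,
    ← fourier_apply, fourier_coe_apply]
  congr 2
  have : (π : ℂ) ≠ 0 := by exact_mod_cast pi_ne_zero
  push_cast
  field_simp

theorem continuous_projT : Continuous (projT (q := q)) :=
  continuous_pi fun j => (AddCircle.continuous_mk' _).comp (continuous_apply j)

theorem integrable_mul_translate {G : EuclideanSpace ℝ (Fin q) → ℂ} (hG : Integrable G) (n : ℝ)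
    (f : C(Torus q, ℂ)) (x : Torus q) :
    Integrable fun w => G w * f (x + projT fun j => 2 * π * w j / n) := by
  refine hG.mul_bdd (c := ‖f‖) (Continuous.aestronglyMeasurable ?_)
    (.of_forall fun w => f.norm_coe_le_norm _)
  refine f.continuous.comp (continuous_const.add (continuous_projT.comp ?_))
  fun_prop

theorem sigmaOp_eq_integral (hh : SmoothCutoff h) {G : EuclideanSpace ℝ (Fin q) → ℂ}
    (hG : Integrable G)
    (hGh : ∀ v : EuclideanSpace ℝ (Fin q), ((h ‖v‖ : ℝ) : ℂ) =
      ∫ w, G w * Complex.exp (((2 * π * inner ℝ w v : ℝ) : ℂ) * Complex.I))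
    {n : ℝ} (hn : 0 < n) {f : C(Torus q, ℂ)} (hf : f ∈ Submodule.span ℂ (Set.range (eK (q := q))))
    (x : Torus q) :
    sigmaOp q h n f x = ∫ w, G w * f (x + projT fun j => 2 * π * w j / n) := by
  induction hf using Submodule.span_induction with
  | mem f hf =>
    obtain ⟨m, rfl⟩ := hf
    have hl2 : l2 m / n =
        ‖(WithLp.toLp 2 fun j => (m j : ℝ) / n : EuclideanSpace ℝ (Fin q))‖ := by
      rw [EuclideanSpace.norm_eq, l2]
      simp only [Real.norm_eq_abs, sq_abs, div_pow]
      rw [← Finset.sum_div, Real.sqrt_div' _ (sq_nonneg n), Real.sqrt_sq hn.le]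
    rw [sigmaOp_eK hh hn, ContinuousMap.smul_apply, hl2, hGh, smul_eq_mul,
      ← integral_mul_const]
    refine integral_congr_ae (.of_forall fun w => ?_)
    simp only [eK_add_projT]
    rw [mul_assoc, mul_comm (Complex.exp _)]
    congr 5
    rw [PiLp.inner_apply, Finset.mul_sum]
    refine Finset.sum_congr rfl fun j _ => ?_
    simp only [RCLike.inner_apply, conj_trivial]
    ring
  | zero => simp [sigmaOp, mFourierCoeff]
  | add f g _ _ hf hg =>
    simp only [sigmaOp_add, ContinuousMap.add_apply, mul_add]
    rw [integral_add (integrable_mul_translate hG n f x) (integrable_mul_translate hG n g x),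
      hf, hg]
  | smul a f _ hf =>
    simp only [sigmaOp_smul, ContinuousMap.smul_apply, smul_eq_mul, mul_left_comm _ a]
    rw [integral_const_mul, hf]

/-- The operators `σ_n` are uniformly bounded in the supremum norm. -/
theorem exists_norm_sigmaOp_le (q : ℕ) (hh : SmoothCutoff h) :
    ∃ C ≥ 0, ∀ n : ℝ, 0 < n → ∀ f : C(Torus q, ℂ), ‖sigmaOp q h n f‖ ≤ C * ‖f‖ := by
  obtain ⟨G, hG, hGh⟩ := hh.exists_integrable_fourierInv (q := q)
  have hC : 0 ≤ ∫ w, ‖G w‖ := integral_nonneg fun _ => norm_nonneg _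
  refine ⟨∫ w, ‖G w‖, hC, fun n hn f => ?_⟩
  have hclosed : IsClosed {f : C(Torus q, ℂ) | ‖sigmaOp q h n f‖ ≤ (∫ w, ‖G w‖) * ‖f‖} :=
    isClosed_le (continuous_sigmaOp n).norm (continuous_const.mul continuous_norm)
  have hf : f ∈ closure (Submodule.span ℂ (Set.range (eK (q := q))) : Set C(Torus q, ℂ)) := by
    rw [← Submodule.topologicalClosure_coe, span_eK_closure_eq_top]
    trivial
  refine closure_minimal (fun T hT => ?_) hclosed hf
  refine (ContinuousMap.norm_le _ (by positivity)).mpr fun x => ?_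
  rw [sigmaOp_eq_integral hh hG hGh hn hT, ← integral_mul_const]
  refine norm_integral_le_of_norm_le (hG.norm.mul_const _) (.of_forall fun w => ?_)
  rw [norm_mul]
  exact mul_le_mul_of_nonneg_left (T.norm_coe_le_norm _) (norm_nonneg _)

theorem sigmaOp_eq_self (hh : SmoothCutoff h) {n : ℝ} (hn : 0 < n) {T : C(Torus q, ℂ)}
    (hT : T ∈ trigSpan q (n / 2)) : sigmaOp q h n T = T := by
  induction hT using Submodule.span_induction with
  | mem T hT =>
    obtain ⟨m, hm, rfl⟩ := hT
    have h0 : 0 ≤ l2 m / n := div_nonneg (Real.sqrt_nonneg _) hn.le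
    rw [sigmaOp_eK hh hn, hh.eq_one, Complex.ofReal_one, one_smul]
    rw [abs_of_nonneg h0, div_le_iff₀ hn]
    linarith
  | zero => simp [sigmaOp, mFourierCoeff]
  | add f g _ _ hf hg => rw [sigmaOp_add, hf, hg]
  | smul a f _ hf => rw [sigmaOp_smul, hf]

theorem norm_sub_sigmaOp_le (hh : SmoothCutoff h) {C n : ℝ} (hC : 0 ≤ C) (hn : 0 < n)
    (hbound : ∀ f : C(Torus q, ℂ), ‖sigmaOp q h n f‖ ≤ C * ‖f‖) (f : C(Torus q, ℂ)) :
    ‖f - sigmaOp q h n f‖ ≤ (1 + C) * degApprox q (n / 2) f := by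
  have hC' : 0 < 1 + C := by linarith
  rw [← div_le_iff₀' hC']
  refine le_ciInf fun T => ?_
  rw [div_le_iff₀' hC']
  have hsplit : sigmaOp q h n f = sigmaOp q h n (f - T) + T := by
    conv_lhs => rw [← sub_add_cancel f (T : C(Torus q, ℂ)), sigmaOp_add, sigmaOp_eq_self hh hn T.2]
  rw [hsplit, show f - (sigmaOp q h n (f - T) + T) = (f - T) - sigmaOp q h n (f - T) by abel,
    add_mul, one_mul]
  exact (norm_sub_le _ _).trans (add_le_add_right (hbound _) _)

end SigmaBound

section Network

variable {q : ℕ} {h : ℝ → ℝ}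

theorem GsigmaOp_apply (φ : C(AddCircle (2 * π), ℂ)) (N : ℕ) (n : ℝ) (f : C(Torus q, ℂ))
    (x : Torus q) :
    GsigmaOp q h φ N n f x = ∑ k ∈ box q n, (((h (l2 k / n) : ℝ) : ℂ) * mFourierCoeff f k) *
      ((fourierCoeff (⇑φ) 1)⁻¹ * neuronAverage N φ (dotk k x)) := by
  simp only [GsigmaOp, Gop, neuronAverage, ContinuousMap.smul_apply, ContinuousMap.sum_apply,
    smul_eq_mul, transK, ContinuousMap.comp_apply, ContinuousMap.coe_mk, Finset.mul_sum]
  rw [Finset.sum_comm]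
  refine Finset.sum_congr rfl fun k _ => Finset.sum_congr rfl fun j _ => ?_
  rw [one_div, mul_inv, one_div]
  ring

theorem card_box_le {n : ℕ} (hn : 1 ≤ n) : ((box q n).card : ℝ) ≤ 3 ^ q * (n : ℝ) ^ q := by
  have hcard : (box q n).card = (2 * n + 1) ^ q := by
    rw [box, Int.ceil_natCast, Pi.card_Icc]
    simp only [Int.card_Icc, Finset.prod_const, Finset.card_univ, Fintype.card_fin]
    congr 1
    omega
  rw [hcard, ← mul_pow]
  push_cast
  have : (1 : ℝ) ≤ n := by exact_mod_cast hn
  gcongr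
  linarith

theorem norm_sigmaOp_sub_GsigmaOp_le (hh : SmoothCutoff h) {φ : C(AddCircle (2 * π), ℂ)}
    (hφ : fourierCoeff (⇑φ) 1 ≠ 0) {n : ℕ} (hn : 1 ≤ n) (N : ℕ) (f : C(Torus q, ℂ)) :
    ‖sigmaOp q h n f - GsigmaOp q h φ N n f‖ ≤
      2 * √(3 ^ q) * ‖fourierCoeff (⇑φ) 1‖⁻¹ *
        ((n : ℝ) ^ ((q : ℝ) / 2) * degApprox1 N φ * ‖f‖) := by
  have hE : 0 ≤ degApprox1 N φ := Real.iInf_nonneg fun _ => norm_nonneg _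
  refine (ContinuousMap.norm_le _ (by positivity)).mpr fun x => ?_
  have hterm (k : Fin q → ℤ) : ‖(((h (l2 k / n) : ℝ) : ℂ) * mFourierCoeff f k) * eK k x -
      (((h (l2 k / n) : ℝ) : ℂ) * mFourierCoeff f k) *
        ((fourierCoeff (⇑φ) 1)⁻¹ * neuronAverage N φ (dotk k x))‖ ≤
      ‖mFourierCoeff f k‖ * (‖fourierCoeff (⇑φ) 1‖⁻¹ * (2 * degApprox1 N φ)) := by
    have hfac : eK k x - (fourierCoeff (⇑φ) 1)⁻¹ * neuronAverage N φ (dotk k x) =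
        (fourierCoeff (⇑φ) 1)⁻¹ *
          (fourierCoeff (⇑φ) 1 * fourier 1 (dotk k x) - neuronAverage N φ (dotk k x)) := by
      rw [fourier_one_dotk, mul_sub, inv_mul_cancel_left₀ hφ]
    rw [← mul_sub, hfac, norm_mul, norm_mul, norm_mul, norm_inv, Complex.norm_real,
      Real.norm_of_nonneg (hh.nonneg _)]
    gcongr
    · exact mul_le_of_le_one_left (norm_nonneg _) (hh.le_one _)
    · exact norm_sub_neuronAverage_le N φ _
  have hsqrt : √((box q n).card : ℝ) ≤ √(3 ^ q) * (n : ℝ) ^ ((q : ℝ) / 2) := by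
    refine (Real.sqrt_le_sqrt (card_box_le hn)).trans_eq ?_
    rw [Real.sqrt_mul (by positivity), Real.sqrt_eq_rpow ((n : ℝ) ^ q), ← Real.rpow_natCast (n : ℝ),
      ← Real.rpow_mul (Nat.cast_nonneg n)]
    congr 2
    ring
  rw [ContinuousMap.sub_apply, GsigmaOp_apply, sigmaOp, ContinuousMap.sum_apply,
    ← Finset.sum_sub_distrib]
  calc _ ≤ ∑ k ∈ box q n, ‖mFourierCoeff f k‖ * (‖fourierCoeff (⇑φ) 1‖⁻¹ * (2 * degApprox1 N φ)) :=
        norm_sum_le_of_le _ fun k _ => hterm k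
    _ ≤ (√(3 ^ q) * (n : ℝ) ^ ((q : ℝ) / 2) * ‖f‖) *
        (‖fourierCoeff (⇑φ) 1‖⁻¹ * (2 * degApprox1 N φ)) := by
      rw [← Finset.sum_mul]
      gcongr
      exact (sum_norm_mFourierCoeff_le f _).trans (by gcongr)
    _ = _ := by ring

end Network

/-- Proposition on periodic activation functions: for `f ∈ C*(𝕋^q)` and
`n, N ≥ 1`, `‖f − 𝔾_N(φ, σ_n(f))‖ ≤ c(φ) { E_{n/2}(q; f) + n^{q/2} E_N(1; φ) ‖f‖ }`. -/
theorem approx_by_network_of_sigma (q : ℕ) (h : ℝ → ℝ) (hh : SmoothCutoff h)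
    (φ : C(AddCircle (2 * π), ℂ)) (hφ : fourierCoeff (⇑φ) 1 ≠ 0) :
    ∃ c > 0, ∀ f : C(Torus q, ℂ), ∀ n N : ℕ, 1 ≤ n → 1 ≤ N →
      ‖f - GsigmaOp q h φ N (n : ℝ) f‖
        ≤ c * (degApprox q ((n : ℝ) / 2) f
            + (n : ℝ) ^ ((q : ℝ) / 2) * degApprox1 (N : ℝ) φ * ‖f‖) := by
  obtain ⟨C, hC, hbound⟩ := exists_norm_sigmaOp_le q hh
  set B : ℝ := 2 * √(3 ^ q) * ‖fourierCoeff (⇑φ) 1‖⁻¹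
  have hB : 0 ≤ B := by positivity
  refine ⟨1 + C + B, by linarith, fun f n N hn _ => ?_⟩
  have hn0 : (0 : ℝ) < n := by exact_mod_cast hn
  have hE : 0 ≤ degApprox q ((n : ℝ) / 2) f := Real.iInf_nonneg fun _ => norm_nonneg _
  have hE1 : 0 ≤ degApprox1 N φ := Real.iInf_nonneg fun _ => norm_nonneg _
  have hR : 0 ≤ (n : ℝ) ^ ((q : ℝ) / 2) * degApprox1 (N : ℝ) φ * ‖f‖ := by positivity
  have h1 := norm_sub_sigmaOp_le hh hC hn0 (hbound n hn0) f
  have h2 := norm_sigmaOp_sub_GsigmaOp_le hh hφ hn N f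
  have h3 := norm_sub_le_norm_sub_add_norm_sub f (sigmaOp q h n f) (GsigmaOp q h φ N n f)
  nlinarith [mul_nonneg hB hE, mul_nonneg hC hR]
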